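/- Let X be a Noetherian scheme that is irreducible, Jacobson and catenary of finite Krull dimension with open regular locus, and let U be a nonempty affine open subscheme contained in the regular locus. If p is a closed point of U with dim O_{U,p} = dim U and i : Spec κ(p) → U the inclusion, then level^{O_U}(i_* κ(p)) = dim O_{U,p} + 1, i.e., the minimal number of cone steps needed to build i_* κ(p) from O_U in D^b_coh(U) is exactly dim O_{U,p} + 1. -/

import Mathlib

open CategoryTheory Limits Pretriangulated Opposite

universe w v u

namespace Paper

variable {C : Type u} [Category.{v} C] [Preadditive C] [HasZeroObject C]
  [HasShift C ℤ] [∀ n : ℤ, (shiftFunctor C n).Additive] [Pretriangulated C]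
  [HasBinaryBiproducts C]

/-- `add S`: smallest strictly full subcategory containing `S` closed under shifts,
finite coproducts and retracts. -/
inductive addClosure (S : Set C) : C → Prop
  | of {X : C} (h : X ∈ S) : addClosure S X
  | zero {X : C} (h : IsZero X) : addClosure S X
  | iso {X Y : C} (e : X ≅ Y) (h : addClosure S X) : addClosure S Y
  | shift {X : C} (n : ℤ) (h : addClosure S X) : addClosure S (X⟦n⟧)
  | biprod {X Y : C} (hX : addClosure S X) (hY : addClosure S Y) : addClosure S (X ⊞ Y)
  | retract {X Y : C} (i : X ⟶ Y) (r : Y ⟶ X) (hir : i ≫ r = 𝟙 X) (h : addClosure S Y) :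
      addClosure S X

/-- objects arising as the cone of a morphism from an object of `A` to an object of `B`,
i.e. `E` with a distinguished triangle `X → Y → E → X[1]`, `X ∈ A`, `Y ∈ B`. -/
def coneSet (A B : Set C) : Set C :=
  {E | ∃ (X Y : C) (f : X ⟶ Y) (g : Y ⟶ E) (h : E ⟶ X⟦(1:ℤ)⟧),
      Triangle.mk f g h ∈ (distTriang C) ∧ X ∈ A ∧ Y ∈ B}

/-- The level filtration `⟨S⟩ₙ`. -/
def level (S : Set C) : ℕ → Set C
  | 0 => addClosure (∅ : Set C)
  | 1 => addClosure S
  | (n+2) => addClosure (coneSet (level S (n+1)) (addClosure S))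

/-- A thick subcategory: triangulated subcategory closed under retracts. -/
structure IsThick (S : Set C) : Prop where
  zero : ∀ X : C, IsZero X → X ∈ S
  iso : ∀ {X Y : C}, (X ≅ Y) → X ∈ S → Y ∈ S
  shift : ∀ (X : C) (n : ℤ), X ∈ S → X⟦n⟧ ∈ S
  ext₂ : ∀ T : Triangle C, T ∈ (distTriang C) → T.obj₁ ∈ S → T.obj₃ ∈ S → T.obj₂ ∈ S
  retract : ∀ {X Y : C} (i : X ⟶ Y) (r : Y ⟶ X), i ≫ r = 𝟙 X → Y ∈ S → X ∈ S

/-- `⟨S⟩`, the smallest thick subcategory of `C` containing `S`. -/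
def thickClosure (S : Set C) : Set C :=
  {X | ∀ T : Set C, IsThick T → S ⊆ T → X ∈ T}

end Paper

namespace Paper

/-- A chain of primes is saturated if no prime can be inserted between consecutive
entries. -/
def IsSaturatedChain {α : Type*} [PartialOrder α] (c : LTSeries α) : Prop :=
  ∀ (i : Fin c.length) (x : α), ¬ (c.toFun i.castSucc < x ∧ x < c.toFun i.succ)

/-- A commutative ring is catenary if any two saturated chains of primes with the same
endpoints have the same length. -/
def IsCatenaryRing (R : Type*) [CommRing R] : Prop :=
  ∀ c₁ c₂ : LTSeries (PrimeSpectrum R),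
    c₁.head = c₂.head → c₁.last = c₂.last →
    IsSaturatedChain c₁ → IsSaturatedChain c₂ → c₁.length = c₂.length

/-- A Noetherian local ring is regular if its maximal ideal is generated by
`dim R` elements. -/
def IsRegularLocalRingAux (S : Type*) [CommRing S] [IsLocalRing S] : Prop :=
  IsNoetherianRing S ∧ ∃ s : Finset S,
    Ideal.span (s : Set S) = IsLocalRing.maximalIdeal S ∧
    (s.card : WithBot (WithTop ℕ)) = ringKrullDim S

end Paper

open IsLocalRing in
theorem isDomain_of_maximalIdeal_eq_span {S : Type*} [CommRing S] [IsLocalRing S]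
    [IsNoetherianRing S] (d : ℕ) (s : Finset S) (hs : Ideal.span (s : Set S) = maximalIdeal S)
    (hcard : s.card ≤ d) (hdim : (d : WithBot ℕ∞) ≤ ringKrullDim S) : IsDomain S := by
  classical
  induction d generalizing S with
  | zero =>
    obtain rfl : s = ∅ := Finset.card_eq_zero.mp (Nat.le_zero.mp hcard)
    have : maximalIdeal S = ⊥ := by simpa using hs.symm
    exact (IsLocalRing.isField_iff_maximalIdeal_eq.mpr this).isDomain
  | succ d ih =>
    have hmin : maximalIdeal S ∉ minimalPrimes S := by
      intro h
      have h0 : (maximalIdeal S).height = 0 := Ideal.height_eq_zero_iff.mpr h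
      rw [← IsLocalRing.maximalIdeal_height_eq_ringKrullDim, h0] at hdim
      norm_cast at hdim
    have hsq : ¬ maximalIdeal S ≤ maximalIdeal S ^ 2 := by
      intro h
      have h0 : maximalIdeal S = ⊥ :=
        Submodule.eq_bot_of_le_smul_of_le_jacobson_bot (maximalIdeal S) (maximalIdeal S)
          (IsNoetherian.noetherian _) (by rwa [smul_eq_mul, ← pow_two])
          (IsLocalRing.maximalIdeal_le_jacobson ⊥)
      refine hmin ⟨⟨inferInstance, bot_le⟩, fun q _ _ ↦ by simp [h0]⟩
    obtain ⟨x, hxm, hx⟩ : ∃ x ∈ maximalIdeal S, x ∉ ⋃ I ∈ insert (maximalIdeal S ^ 2)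
        (minimalPrimes S), (I : Set S) := by
      by_contra! h
      obtain ⟨I, hI, hle⟩ := (Ideal.subset_union_prime_finite (f := id)
        ((minimalPrimes.finite_of_isNoetherianRing S).insert (maximalIdeal S ^ 2))
        (maximalIdeal S ^ 2) (maximalIdeal S ^ 2) (by
          rintro I (rfl | hI) h1 _
          · exact absurd rfl h1
          · exact hI.1.1)).mp h
      obtain rfl | hI := hI
      · exact hsq hle
      · have := hI.1.1
        exact hmin (((IsLocalRing.maximalIdeal.isMaximal S).eq_of_le this.ne_top hle) ▸ hI)
    simp only [Set.mem_iUnion, SetLike.mem_coe, Set.mem_insert_iff, not_exists] at hx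
    have hx2 : x ∉ maximalIdeal S ^ 2 := fun h ↦ hx _ (Or.inl rfl) h
    obtain ⟨a, ha⟩ : ∃ a : S → S, ∑ i ∈ s, a i * i = x := by
      rw [← hs] at hxm
      obtain ⟨f, -, hf⟩ := Submodule.mem_span_finset.mp hxm
      exact ⟨f, by simpa using hf⟩
    obtain ⟨i, his, hi⟩ : ∃ i ∈ s, IsUnit (a i) := by
      by_contra! h
      refine hx2 (ha ▸ Ideal.sum_mem _ fun i hi ↦ ?_)
      rw [pow_two]
      exact Ideal.mul_mem_mul ((mem_maximalIdeal _).mpr (h i hi)) (hs ▸ Ideal.subset_span hi)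
    have : Nontrivial (S ⧸ Ideal.span {x}) := Ideal.Quotient.nontrivial_iff.mpr
      (ne_top_of_le_ne_top (maximalIdeal.isMaximal S).ne_top
        ((Ideal.span_singleton_le_iff_mem _).mpr hxm))
    have : IsLocalRing (S ⧸ Ideal.span {x}) :=
      .of_surjective' (Ideal.Quotient.mk _) Ideal.Quotient.mk_surjective
    have hQ : IsDomain (S ⧸ Ideal.span {x}) := by
      refine ih ((s.erase i).image (Ideal.Quotient.mk _)) ?_ ?_ ?_
      · have hmap : maximalIdeal (S ⧸ Ideal.span {x}) =
            (maximalIdeal S).map (Ideal.Quotient.mk _) :=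
          (IsLocalRing.map_maximalIdeal_of_surjective _ Ideal.Quotient.mk_surjective).symm
        rw [hmap, ← hs, Ideal.map_span, Finset.coe_image]
        refine le_antisymm (Ideal.span_mono (Set.image_mono (by simp))) (Ideal.span_le.mpr ?_)
        rintro _ ⟨j, hj, rfl⟩
        have hmem : ∀ j ∈ s, j ≠ i → Ideal.Quotient.mk (Ideal.span {x}) j ∈
            Ideal.span (Ideal.Quotient.mk (Ideal.span {x}) '' (s.erase i)) := fun j hj hne ↦
          Ideal.subset_span ⟨j, by simp [hne, Finset.mem_coe.mp hj], rfl⟩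
        by_cases hji : j = i
        · subst hji
          have h0 : Ideal.Quotient.mk (Ideal.span {x}) (∑ k ∈ s, a k * k) = 0 := by
            rw [ha]
            exact Ideal.Quotient.eq_zero_iff_mem.mpr (Ideal.mem_span_singleton_self x)
          rw [← Finset.add_sum_erase _ _ his, map_add, map_mul] at h0
          have hu := hi.map (Ideal.Quotient.mk (Ideal.span {x}))
          refine (Ideal.unit_mul_mem_iff_mem _ hu).mp ?_
          rw [eq_neg_of_add_eq_zero_left h0, map_sum]
          refine neg_mem (Ideal.sum_mem _ fun k hk ↦ ?_)
          rw [map_mul]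
          exact Ideal.mul_mem_left _ _
            (hmem k (Finset.mem_of_mem_erase hk) (Finset.ne_of_mem_erase hk))
        · exact hmem j hj hji
      · have := Finset.card_erase_of_mem his
        have := Finset.card_image_le (s := s.erase i) (f := Ideal.Quotient.mk (Ideal.span {x}))
        omega
      · have h1 := ringKrullDim_le_ringKrullDim_quotient_add_encard {x}
          (by simpa [IsLocalRing.ringJacobson_eq_maximalIdeal] using hxm)
        have h2 := hdim.trans h1
        simp only [Set.encard_singleton] at h2
        push_cast at h2
        exact ENat.WithBot.add_le_add_one_right_iff.mp h2
    have hprime : (Ideal.span {x}).IsPrime := (Ideal.Quotient.isDomain_iff_prime _).mp hQ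
    obtain ⟨P, hP, hPx⟩ := Ideal.exists_minimalPrimes_le (bot_le : ⊥ ≤ Ideal.span {x})
    have hPp := hP.1.1
    have hxP : x ∉ P := fun h ↦ hx P (Or.inr hP) h
    have hP0 : P = ⊥ := by
      refine Submodule.eq_bot_of_le_smul_of_le_jacobson_bot (maximalIdeal S) P
        (IsNoetherian.noetherian _) (fun y hy ↦ ?_) (IsLocalRing.maximalIdeal_le_jacobson ⊥)
      obtain ⟨z, rfl⟩ := Ideal.mem_span_singleton.mp (hPx hy)
      exact Submodule.smul_mem_smul hxm ((hPp.mem_or_mem hy).resolve_left hxP)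
    subst hP0
    exact IsDomain.of_bot_isPrime S

open IsLocalRing RingTheory.Sequence in
theorem isWeaklyRegular_of_ofList_eq_maximalIdeal {S : Type*} [CommRing S] [IsLocalRing S]
    [IsNoetherianRing S] (rs : List S) (hrs : Ideal.ofList rs = maximalIdeal S)
    (hdim : (rs.length : WithBot ℕ∞) ≤ ringKrullDim S) : IsWeaklyRegular S rs := by
  classical
  induction hd : rs.length generalizing S with
  | zero => simp [List.length_eq_zero_iff.mp hd]
  | succ d ih =>
    match rs with
    | x :: rs =>
    rw [hd] at hdim
    simp only [List.length_cons, Nat.add_right_cancel_iff] at hd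
    have hspan : ∀ l : List S, Ideal.span (l.toFinset : Set S) = Ideal.ofList l := fun l ↦ by
      simp [Ideal.ofList]
    have : IsDomain S := isDomain_of_maximalIdeal_eq_span (d + 1) (x :: rs).toFinset
      ((hspan _).trans hrs) ((List.toFinset_card_le _).trans (by simp [hd])) hdim
    have hx0 : x ≠ 0 := by
      rintro rfl
      rw [Ideal.ofList_cons, Ideal.span_singleton_eq_bot.mpr rfl, bot_sup_eq, ← hspan] at hrs
      have h1 := ringKrullDim_le_ringKrullDim_quotient_add_card (R := S) rs.toFinset
        (by rw [IsLocalRing.ringJacobson_eq_maximalIdeal, ← hrs]; exact Ideal.subset_span)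
      rw [hrs] at h1
      have h2 : ringKrullDim (S ⧸ maximalIdeal S) = 0 :=
        ringKrullDim_eq_zero_of_isField
          ((Ideal.Quotient.maximal_ideal_iff_isField_quotient _).mp inferInstance)
      rw [h2, zero_add] at h1
      have h3 := hdim.trans h1
      have h4 := rs.toFinset_card_le
      norm_cast at h3
      omega
    have hxm : x ∈ maximalIdeal S := hrs ▸ Ideal.subset_span (by simp)
    have : Nontrivial (S ⧸ Ideal.span {x}) := Ideal.Quotient.nontrivial_iff.mpr
      (ne_top_of_le_ne_top (maximalIdeal.isMaximal S).ne_top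
        ((Ideal.span_singleton_le_iff_mem _).mpr hxm))
    have : IsLocalRing (S ⧸ Ideal.span {x}) :=
      .of_surjective' (Ideal.Quotient.mk _) Ideal.Quotient.mk_surjective
    have hQ : IsWeaklyRegular (S ⧸ Ideal.span {x})
        (rs.map (algebraMap S (S ⧸ Ideal.span {x}))) := by
      refine ih _ ?_ ?_ (by simpa)
      · rw [← Ideal.map_ofList, ← IsLocalRing.map_maximalIdeal_of_surjective
          (Ideal.Quotient.mk (Ideal.span {x})) Ideal.Quotient.mk_surjective, ← hrs,
          Ideal.ofList_cons, Ideal.map_sup, Ideal.map_quotient_self, bot_sup_eq]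
        rfl
      · have h1 := ringKrullDim_le_ringKrullDim_quotient_add_encard {x}
          (by simpa [IsLocalRing.ringJacobson_eq_maximalIdeal] using hxm)
        have h2 := hdim.trans h1
        simp only [Set.encard_singleton] at h2
        push_cast at h2
        rw [List.length_map, hd]
        exact ENat.WithBot.add_le_add_one_right_iff.mp h2
    refine .cons (IsSMulRegular.of_ne_zero hx0) ?_
    rw [isWeaklyRegular_map_algebraMap_iff] at hQ
    exact ((Submodule.quotEquivOfEq _ _ (by
      rw [← Submodule.ideal_span_singleton_smul]; simp)).isWeaklyRegular_congr rs).mpr hQ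

open IsLocalRing in
theorem projectiveDimension_residueField_eq_card {S : Type} [CommRing S] [IsLocalRing S]
    [IsNoetherianRing S] (s : Finset S) (hs : Ideal.span (s : Set S) = maximalIdeal S)
    (hdim : (s.card : WithBot ℕ∞) ≤ ringKrullDim S) :
    projectiveDimension (ModuleCat.of S (S ⧸ maximalIdeal S)) = s.card := by
  have hspan : Ideal.ofList s.toList = maximalIdeal S := by
    rw [← hs]
    simp [Ideal.ofList]
  have hlen : s.toList.length = s.card := s.length_toList
  have hreg : RingTheory.Sequence.IsRegular S s.toList :=
    ⟨isWeaklyRegular_of_ofList_eq_maximalIdeal _ hspan (hlen ▸ hdim), by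
      rw [hspan, smul_eq_mul, Ideal.mul_top]
      exact (maximalIdeal.isMaximal S).ne_top.symm⟩
  rw [← hlen, ← ModuleCat.projectiveDimension_quotient_eq_length.{0} s.toList hreg]
  exact ModuleCat.projectiveDimension_eq_of_linearEquiv
    ((Submodule.quotEquivOfEq _ _ hspan.symm).trans (Shrink.linearEquiv S _).symm)

open IsLocalRing in
theorem projectiveDimension_quotient_isMaximal {R : Type} [CommRing R] [IsNoetherianRing R]
    (p : Ideal R) [p.IsMaximal] :
    projectiveDimension (ModuleCat.of R (R ⧸ p)) =
      projectiveDimension (ModuleCat.of (Localization.AtPrime p)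
        (Localization.AtPrime p ⧸ maximalIdeal (Localization.AtPrime p))) := by
  rw [ModuleCat.projectiveDimension_eq_iSup_localizedModule_maximal]
  have key : projectiveDimension ((ModuleCat.of R (R ⧸ p)).localizedModule p.primeCompl) =
      projectiveDimension (ModuleCat.of (Localization.AtPrime p)
        (Localization.AtPrime p ⧸ maximalIdeal (Localization.AtPrime p))) := by
    have h : p.localized' (Localization.AtPrime p) p.primeCompl
        (Algebra.linearMap R (Localization.AtPrime p)) =
          maximalIdeal (Localization.AtPrime p) := by
      rw [Ideal.localized'_eq_map, Localization.AtPrime.map_eq_maximalIdeal]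
    have := ModuleCat.localizedModule_isLocalizedModule (ModuleCat.of R (R ⧸ p)) p.primeCompl
    let e := LinearEquiv.extendScalarsOfIsLocalization p.primeCompl (Localization.AtPrime p)
      (IsLocalizedModule.linearEquiv p.primeCompl
        ((ModuleCat.of R (R ⧸ p)).localizedModuleMkLinearMap p.primeCompl)
        (Submodule.toLocalizedQuotient' (Localization.AtPrime p) p.primeCompl
          (Algebra.linearMap R (Localization.AtPrime p)) p))
    exact ModuleCat.projectiveDimension_eq_of_linearEquiv
      (e.trans (Submodule.quotEquivOfEq _ _ h))
  refine le_antisymm (iSup_le fun m ↦ ?_) ?_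
  · by_cases hm : m.asIdeal = p
    · obtain ⟨m, hm'⟩ := m
      subst hm
      exact key.le
    · obtain ⟨x, hxp, hxm⟩ : ∃ x ∈ p, x ∉ m.asIdeal := by
        by_contra! h
        exact hm ((‹p.IsMaximal›).eq_of_le m.isMaximal.ne_top h).symm
      have : Subsingleton (LocalizedModule m.asIdeal.primeCompl (R ⧸ p)) := by
        rw [LocalizedModule.subsingleton_iff]
        intro y
        refine ⟨x, hxm, ?_⟩
        obtain ⟨y, rfl⟩ := Ideal.Quotient.mk_surjective y
        rw [Algebra.smul_def, Ideal.Quotient.algebraMap_eq, ← map_mul]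
        exact Ideal.Quotient.eq_zero_iff_mem.mpr (p.mul_mem_right _ hxp)
      have hbot : projectiveDimension
          ((ModuleCat.of R (R ⧸ p)).localizedModule m.asIdeal.primeCompl) = ⊥ := by
        rw [projectiveDimension_eq_bot_iff, ModuleCat.isZero_iff_subsingleton]
        exact (equivShrink (LocalizedModule m.asIdeal.primeCompl (R ⧸ p))).symm.subsingleton
      rw [hbot]
      exact bot_le
  · rw [← key]
    exact le_iSup (fun m : MaximalSpectrum R ↦ projectiveDimension
      ((ModuleCat.of R (R ⧸ p)).localizedModule m.asIdeal.primeCompl)) ⟨p, inferInstance⟩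

section Upper

open Paper DerivedCategory

variable {R : Type} [CommRing R] [HasDerivedCategory (ModuleCat R)]
  [HasBinaryBiproducts (DerivedCategory (ModuleCat R))]

theorem singleFunctor_obj_fin_pi_mem_addClosure (m : ℕ) :
    addClosure {(singleFunctor (ModuleCat R) 0).obj (ModuleCat.of R R)}
      ((singleFunctor (ModuleCat R) 0).obj (ModuleCat.of R (Fin m → R))) := by
  induction m with
  | zero =>
    exact .zero ((singleFunctor (ModuleCat R) 0).map_isZero
      (ModuleCat.isZero_of_subsingleton _))
  | succ m ih =>
    let e : ModuleCat.of R R ⊞ ModuleCat.of R (Fin m → R) ≅ ModuleCat.of R (Fin (m + 1) → R) :=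
      ModuleCat.biprodIsoProd _ _ ≪≫
        (Fin.consLinearEquiv R (fun _ : Fin (m + 1) ↦ R)).toModuleIso
    have := preservesBinaryBiproducts_of_preservesBiproducts (singleFunctor (ModuleCat R) 0)
    exact .iso (((singleFunctor (ModuleCat R) 0).mapBiprod
      (ModuleCat.of R R) (ModuleCat.of R (Fin m → R))).symm ≪≫
      (singleFunctor (ModuleCat R) 0).mapIso e) (.biprod (.of rfl) ih)

theorem singleFunctor_obj_projective_mem_addClosure (P : Type) [AddCommGroup P] [Module R P]
    [Module.Finite R P] [Module.Projective R P] :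
    addClosure {(singleFunctor (ModuleCat R) 0).obj (ModuleCat.of R R)}
      ((singleFunctor (ModuleCat R) 0).obj (ModuleCat.of R P)) := by
  obtain ⟨m, f, g, -, -, h⟩ := Module.Finite.exists_comp_eq_id_of_projective R P
  refine .retract ((singleFunctor (ModuleCat R) 0).map (ModuleCat.ofHom g))
    ((singleFunctor (ModuleCat R) 0).map (ModuleCat.ofHom f)) ?_
    (singleFunctor_obj_fin_pi_mem_addClosure m)
  rw [← Functor.map_comp, ← ModuleCat.ofHom_comp, h]
  exact (singleFunctor (ModuleCat R) 0).map_id _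

theorem singleFunctor_obj_mem_level [IsNoetherianRing R] (n : ℕ) (M : ModuleCat.{0} R)
    [Module.Finite R M] [HasProjectiveDimensionLT M (n + 1)] :
    (singleFunctor (ModuleCat R) 0).obj M ∈
      level {(singleFunctor (ModuleCat R) 0).obj (ModuleCat.of R R)} (n + 1) := by
  induction n generalizing M with
  | zero =>
    have : Projective M := projective_iff_hasProjectiveDimensionLT_one.mpr inferInstance
    have : Module.Projective R M := (IsProjective.iff_projective M).mpr inferInstance
    exact singleFunctor_obj_projective_mem_addClosure M
  | succ n ih =>
    obtain ⟨P, _, _, _, _, f, surjf⟩ := Module.exists_finite_presentation R M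
    have hS := LinearMap.shortExact_shortComplexKer surjf
    have : Projective (ModuleCat.of R P) := (IsProjective.iff_projective P).mp inferInstance
    have h1 : HasProjectiveDimensionLT f.shortComplexKer.X₁ (n + 1) :=
      (hS.hasProjectiveDimensionLT_X₃_iff n this).mp ‹_›
    exact .of ⟨_, _, _, _, _, hS.singleTriangle_distinguished, ih f.shortComplexKer.X₁,
      singleFunctor_obj_projective_mem_addClosure P⟩

end Upper

section Ghost

open Paper

variable {C : Type u} [Category.{v} C] [Preadditive C] [HasShift C ℤ]

/-- Compositions of `n` maps, each of which is killed by precomposition with every map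
from a shift of an object of `S`. -/
def ghostPow (S : Set C) : ℕ → MorphismProperty C
  | 0 => ⊤
  | n + 1 => fun X Y f ↦ ∃ (W : C) (g : X ⟶ W) (h : W ⟶ Y),
      (∀ A ∈ S, ∀ (i : ℤ) (a : A⟦i⟧ ⟶ X), a ≫ g = 0) ∧ ghostPow S n h ∧ g ≫ h = f

theorem ghostPow_comp (S : Set C) (n : ℕ) {X Y Z : C} (f : X ⟶ Y) (k : Y ⟶ Z)
    (hf : ghostPow S n f) : ghostPow S n (f ≫ k) := by
  induction n generalizing X with
  | zero => trivial
  | succ n ih =>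
    obtain ⟨W, g, h, hg, hh, rfl⟩ := hf
    exact ⟨W, g, h ≫ k, hg, ih h hh, (Category.assoc _ _ _).symm⟩

/-- Objects from which every map is killed by postcomposition with the morphisms in `G`. -/
def leftOrthogonal (G : MorphismProperty C) : Set C :=
  {E | ∀ ⦃X Y : C⦄ (f : X ⟶ Y), G f → ∀ a : E ⟶ X, a ≫ f = 0}

variable [∀ n : ℤ, (shiftFunctor C n).Additive]

theorem ghostPow_shift (S : Set C) (n : ℕ) ⦃X Y : C⦄ (f : X ⟶ Y) (m : ℤ)
    (hf : ghostPow S n f) : ghostPow S n (f⟦m⟧') := by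
  induction n generalizing X Y with
  | zero => trivial
  | succ n ih =>
    obtain ⟨W, g, h, hg, hh, rfl⟩ := hf
    refine ⟨_, g⟦m⟧', h⟦m⟧', fun A hA i a ↦ ?_, ih h hh, (Functor.map_comp _ _ _).symm⟩
    have h0 := hg A hA (i + -m) ((shiftFunctorAdd C i (-m)).hom.app A ≫ a⟦-m⟧' ≫
      (shiftShiftNeg X m).hom)
    have h1 : (a ≫ g⟦m⟧')⟦-m⟧' ≫ (shiftShiftNeg W m).hom = 0 := by
      rw [← Preadditive.IsIso.comp_left_eq_zero ((shiftFunctorAdd C i (-m)).hom.app A), ← h0]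
      simp only [Functor.map_comp, Category.assoc]
      congr 2
      exact (shiftFunctorCompIsoId C m (-m) (by simp)).hom.naturality g
    rw [Preadditive.IsIso.comp_right_eq_zero] at h1
    exact (shiftFunctor C (-m)).map_injective (h1.trans (Functor.map_zero _ _ _).symm)

theorem shift_mem_leftOrthogonal {G : MorphismProperty C}
    (hG : ∀ ⦃X Y : C⦄ (f : X ⟶ Y) (n : ℤ), G f → G (f⟦n⟧')) {E : C}
    (hE : E ∈ leftOrthogonal G) (n : ℤ) : E⟦n⟧ ∈ leftOrthogonal G := by
  intro X Y f hf a
  have h := hE _ (hG f (-n) hf) ((shiftShiftNeg E n).inv ≫ a⟦-n⟧')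
  rw [Category.assoc, ← Functor.map_comp, Preadditive.IsIso.comp_left_eq_zero] at h
  exact (shiftFunctor C (-n)).map_injective (h.trans (Functor.map_zero _ _ _).symm)

variable [HasBinaryBiproducts C]

theorem addClosure_subset_leftOrthogonal {G : MorphismProperty C}
    (hG : ∀ ⦃X Y : C⦄ (f : X ⟶ Y) (n : ℤ), G f → G (f⟦n⟧')) {T : Set C}
    (hT : T ⊆ leftOrthogonal G) {E : C} (hE : addClosure T E) : E ∈ leftOrthogonal G := by
  induction hE with
  | of h => exact hT h
  | zero h => exact fun X Y f _ a ↦ by rw [h.eq_of_src a 0, zero_comp]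
  | iso e _ ih =>
    intro X Y f hf a
    rw [← Preadditive.IsIso.comp_left_eq_zero e.hom, ← Category.assoc]
    exact ih f hf _
  | shift n _ ih => exact shift_mem_leftOrthogonal hG ih n
  | biprod _ _ ih₁ ih₂ =>
    intro X Y f hf a
    refine biprod.hom_ext' _ _ ?_ ?_
    · rw [← Category.assoc, ih₁ f hf, comp_zero]
    · rw [← Category.assoc, ih₂ f hf, comp_zero]
  | retract i r hir _ ih =>
    intro X Y f hf a
    rw [← Category.id_comp (a ≫ f), ← hir, Category.assoc, ← Category.assoc r, ih f hf, comp_zero]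

variable [HasZeroObject C] [Pretriangulated C]

/-- The ghost lemma. -/
theorem level_subset_leftOrthogonal_ghostPow (S : Set C) (n : ℕ) :
    level S n ⊆ leftOrthogonal (ghostPow S n) := by
  have hS : ∀ E, addClosure S E → E ∈ leftOrthogonal (ghostPow S 1) := fun E hE ↦ by
    refine addClosure_subset_leftOrthogonal (ghostPow_shift S 1) (fun A hA ↦ ?_) hE
    rintro X Y _ ⟨W, g, h, hg, -, rfl⟩ a
    have := hg A hA 0 ((shiftFunctorZero C ℤ).hom.app A ≫ a)
    rw [Category.assoc, Preadditive.IsIso.comp_left_eq_zero] at this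
    rw [← Category.assoc, this, zero_comp]
  match n with
  | 0 => exact fun E hE ↦
      addClosure_subset_leftOrthogonal (ghostPow_shift S 0) (Set.empty_subset _) hE
  | 1 => exact fun E hE ↦ hS E hE
  | n + 2 =>
    refine fun E hE ↦ addClosure_subset_leftOrthogonal (ghostPow_shift S (n + 2)) ?_ hE
    rintro E ⟨X, Y, u, v, w, hT, hX, hY⟩ Z V _ ⟨W, g, h, hg, hh, rfl⟩ a
    obtain ⟨b, hb⟩ : ∃ b : X⟦(1 : ℤ)⟧ ⟶ W, a ≫ g = w ≫ b :=
      Triangle.yoneda_exact₃ _ hT (a ≫ g) (by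
        have := hS _ hY g ⟨W, g, 𝟙 W, hg, trivial, Category.comp_id g⟩ (v ≫ a)
        rwa [Category.assoc] at this)
    have := shift_mem_leftOrthogonal (ghostPow_shift S (n + 1))
      (level_subset_leftOrthogonal_ghostPow S (n + 1) hX) 1 h hh b
    rw [← Category.assoc, hb, Category.assoc, this, comp_zero]

end Ghost

section Lower

open Paper DerivedCategory Abelian

theorem singleFunctor_shift_hom_eq_zero {A : Type u} [Category.{v} A] [Abelian A]
    [HasDerivedCategory.{w} A] (P N : A) [Projective P] {i j : ℤ} (hij : i ≠ j)
    (f : ((singleFunctor A 0).obj P)⟦i⟧ ⟶ ((singleFunctor A 0).obj N)⟦j⟧) : f = 0 := by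
  obtain hij | hij := hij.lt_or_gt
  · have : HasExt.{w} A := hasExt_of_hasDerivedCategory A
    obtain ⟨k, rfl⟩ : ∃ k : ℕ, j = ((k + 1 : ℕ) : ℤ) + i := ⟨(j - i - 1).toNat, by lia⟩
    obtain ⟨g, hg⟩ := (shiftFunctor _ i).map_surjective
      (f ≫ (shiftFunctorAdd _ ((k + 1 : ℕ) : ℤ) i).hom.app ((singleFunctor A 0).obj N))
    have : g = 0 := (Ext.homEquiv (C := A)).symm.injective
      ((Ext.eq_zero_of_projective _).trans (Ext.eq_zero_of_projective _).symm)
    rwa [this, Functor.map_zero, eq_comm, Preadditive.IsIso.comp_right_eq_zero] at hg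
  · suffices ∀ f : (Q.obj ((CochainComplex.singleFunctor A 0).obj P))⟦i⟧ ⟶
      (Q.obj ((CochainComplex.singleFunctor A 0).obj N))⟦j⟧, f = 0 from this f
    intro f
    rw [← cancel_mono ((Q.commShiftIso j).inv.app _), ← cancel_epi ((Q.commShiftIso i).hom.app _)]
    have : (((CochainComplex.singleFunctor A 0).obj P)⟦i⟧).IsStrictlyLE (-i) :=
      CochainComplex.isStrictlyLE_shift _ 0 _ _ (by lia)
    have : (((CochainComplex.singleFunctor A 0).obj N)⟦j⟧).IsStrictlyGE (-j) :=
      CochainComplex.isStrictlyGE_shift _ 0 _ _ (by lia)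
    apply (subsingleton_hom_of_isStrictlyLE_of_isStrictlyGE _ _ (-i) (-j) (by lia)).elim

variable {R : Type} [CommRing R] [HasDerivedCategory (ModuleCat R)]

theorem ghostPow_ext_hom (n : ℕ) (M N : ModuleCat.{0} R) (e : Ext M N n) :
    ghostPow {(singleFunctor (ModuleCat R) 0).obj (ModuleCat.of R R)} n e.hom := by
  induction n generalizing M with
  | zero => trivial
  | succ n ih =>
    have hS := M.shortExact_projectiveShortComplex
    obtain ⟨e, rfl⟩ := precomp_extClass_surjective_of_projective_X₂ N hS n e
    refine ⟨_, hS.singleδ, (e.hom⟦(1 : ℤ)⟧') ≫ (shiftFunctorAdd' _ _ _ _ (by lia)).inv.app _,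
      ?_, ghostPow_comp _ _ _ _ (ghostPow_shift _ _ _ _ (ih _ e)), ?_⟩
    · rintro _ rfl i a
      have : Projective (ModuleCat.of R R) := (IsProjective.iff_projective R).mp inferInstance
      by_cases hi : i = 0
      · exact singleFunctor_shift_hom_eq_zero _ _ (by lia) _
      · have h0 := singleFunctor_shift_hom_eq_zero _ _ hi
          (a ≫ ((shiftFunctorZero _ ℤ).symm.app ((singleFunctor (ModuleCat R) 0).obj M)).hom)
        rw [Preadditive.IsIso.comp_right_eq_zero] at h0
        rw [h0, zero_comp]
    · rw [← hS.extClass_hom]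
      exact (Ext.comp_hom hS.extClass e (add_comm 1 n)).symm

theorem hasProjectiveDimensionLT_of_singleFunctor_obj_mem_level [IsNoetherianRing R]
    [HasBinaryBiproducts (DerivedCategory (ModuleCat R))]
    (n : ℕ) (M : ModuleCat.{0} R) [Module.Finite R M]
    (hM : (singleFunctor (ModuleCat R) 0).obj M ∈
      level {(singleFunctor (ModuleCat R) 0).obj (ModuleCat.of R R)} n) :
    HasProjectiveDimensionLT M n := by
  refine ModuleCat.hasProjectiveDimensionLT_of_forall_finite M n fun L _ ↦ ?_
  refine subsingleton_of_forall_eq 0 fun e ↦ Ext.ext ?_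
  have := level_subset_leftOrthogonal_ghostPow _ n hM _ (ghostPow_ext_hom n M L e) (𝟙 _)
  rwa [Category.id_comp, ← Ext.zero_hom] at this

end Lower

open Paper in
/-- **Levels of residue fields**: for `U = Spec R` a nonempty affine open inside the
regular locus of an irreducible, Jacobson, catenary Noetherian scheme of finite Krull
dimension, and `p` a closed point with `dim O_{U,p} = dim U = d`, building
`i_* κ(p)` from `O_U` in `D^b_coh(U)` takes exactly `d + 1` cone steps. -/
theorem statement14 (R : Type) [CommRing R] [IsNoetherianRing R] [IsDomain R]
    [IsJacobsonRing R] (hcat : IsCatenaryRing R)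
    (hreg : ∀ (q : Ideal R) [q.IsPrime], IsRegularLocalRingAux (Localization.AtPrime q))
    (d : ℕ) (hfin : ringKrullDim R = ((d : ℕ) : WithBot (WithTop ℕ)))
    (p : Ideal R) [hp : p.IsMaximal]
    (hloc : ringKrullDim (Localization.AtPrime p) = ((d : ℕ) : WithBot (WithTop ℕ)))
    [HasDerivedCategory (ModuleCat R)]
    [HasBinaryBiproducts (DerivedCategory (ModuleCat R))] :
    ((DerivedCategory.singleFunctor (ModuleCat R) 0).obj (ModuleCat.of R (R ⧸ p)) ∈
      level ({(DerivedCategory.singleFunctor (ModuleCat R) 0).obj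
        (ModuleCat.of R R)} : Set (DerivedCategory (ModuleCat R))) (d + 1)) ∧
    (∀ n : ℕ,
      (DerivedCategory.singleFunctor (ModuleCat R) 0).obj (ModuleCat.of R (R ⧸ p)) ∈
        level ({(DerivedCategory.singleFunctor (ModuleCat R) 0).obj
          (ModuleCat.of R R)} : Set (DerivedCategory (ModuleCat R))) n →
      d + 1 ≤ n) := by
  obtain ⟨_, s, hs, hcard⟩ := hreg p
  have hsd : s.card = d := by
    rw [hloc] at hcard
    exact_mod_cast hcard
  have hpd : projectiveDimension (ModuleCat.of R (R ⧸ p)) = d := by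
    rw [projectiveDimension_quotient_isMaximal p,
      projectiveDimension_residueField_eq_card s hs hcard.le, hsd]
  have hlt (n : ℕ) : HasProjectiveDimensionLT (ModuleCat.of R (R ⧸ p)) n ↔ d < n := by
    rw [← projectiveDimension_lt_iff, hpd]
    exact_mod_cast Iff.rfl
  refine ⟨?_, fun n hn ↦ (hlt n).mp ?_⟩
  · have := (hlt (d + 1)).mpr d.lt_succ_self
    exact singleFunctor_obj_mem_level d _
  · exact hasProjectiveDimensionLT_of_singleFunctor_obj_mem_level n _ hn
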